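/- arXiv:0904.3210 — 2 statements merged into one kernel-verified Lean document; each statement's English description precedes it below -/
import Mathlib

section
/- The stochastic-limit generator L applied to the share number operator n̂ gives L(n̂) = 2·Re(Γ_Z^b)·z z† − 2·Re(Γ_Z^a)·z†z as linear operators on V. -/
/- Context: V is the free complex vector space on the basis
{φ_{n,k,m} : n, k, m ∈ ℕ} (share number n, cash k, price m). -/

noncomputable section

abbrev V3 := (ℕ × ℕ × ℕ) →₀ ℂ

/-- a : φ_{n,k,m} ↦ √n φ_{n−1,k,m}. -/
def aOp : Module.End ℂ V3 :=
  Finsupp.lift _ ℂ (ℕ × ℕ × ℕ) fun i =>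
    Finsupp.single (i.1 - 1, i.2.1, i.2.2) ((Real.sqrt i.1 : ℝ) : ℂ)

/-- a† : φ_{n,k,m} ↦ √(n+1) φ_{n+1,k,m}. -/
def adag : Module.End ℂ V3 :=
  Finsupp.lift _ ℂ (ℕ × ℕ × ℕ) fun i =>
    Finsupp.single (i.1 + 1, i.2.1, i.2.2) ((Real.sqrt (i.1 + 1) : ℝ) : ℂ)

/-- c : φ_{n,k,m} ↦ √k φ_{n,k−1,m}. -/
def cOp : Module.End ℂ V3 :=
  Finsupp.lift _ ℂ (ℕ × ℕ × ℕ) fun i =>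
    Finsupp.single (i.1, i.2.1 - 1, i.2.2) ((Real.sqrt i.2.1 : ℝ) : ℂ)

/-- c† : φ_{n,k,m} ↦ √(k+1) φ_{n,k+1,m}. -/
def cdag : Module.End ℂ V3 :=
  Finsupp.lift _ ℂ (ℕ × ℕ × ℕ) fun i =>
    Finsupp.single (i.1, i.2.1 + 1, i.2.2) ((Real.sqrt (i.2.1 + 1) : ℝ) : ℂ)

/-- p : φ_{n,k,m} ↦ √m φ_{n,k,m−1}. -/
def pOp : Module.End ℂ V3 :=
  Finsupp.lift _ ℂ (ℕ × ℕ × ℕ) fun i =>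
    Finsupp.single (i.1, i.2.1, i.2.2 - 1) ((Real.sqrt i.2.2 : ℝ) : ℂ)

/-- p† : φ_{n,k,m} ↦ √(m+1) φ_{n,k,m+1}. -/
def pdag : Module.End ℂ V3 :=
  Finsupp.lift _ ℂ (ℕ × ℕ × ℕ) fun i =>
    Finsupp.single (i.1, i.2.1, i.2.2 + 1) ((Real.sqrt (i.2.2 + 1) : ℝ) : ℂ)

/-- n̂ = a†a. -/
def nhat : Module.End ℂ V3 := adag * aOp
/-- k̂ = c†c. -/
def khat : Module.End ℂ V3 := cdag * cOp
/-- P̂ = p†p. -/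
def Phat : Module.End ℂ V3 := pdag * pOp

/-- c^P̂ : φ_{n,k,m} ↦ φ_{n,k,m} if m = 0; 0 if m > k;
√(k(k−1)⋯(k−m+1)) φ_{n,k−m,m} if 0 < m ≤ k. -/
def cPowP : Module.End ℂ V3 :=
  Finsupp.lift _ ℂ (ℕ × ℕ × ℕ) fun i =>
    if i.2.2 ≤ i.2.1 then
      Finsupp.single (i.1, i.2.1 - i.2.2, i.2.2)
        ((Real.sqrt (∏ j ∈ Finset.range i.2.2, ((i.2.1 : ℝ) - j)) : ℝ) : ℂ)
    else 0

/-- (c†)^P̂ : φ_{n,k,m} ↦ φ_{n,k,m} if m = 0;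
√((k+1)⋯(k+m)) φ_{n,k+m,m} if m > 0. -/
def cdagPowP : Module.End ℂ V3 :=
  Finsupp.lift _ ℂ (ℕ × ℕ × ℕ) fun i =>
    Finsupp.single (i.1, i.2.1 + i.2.2, i.2.2)
      ((Real.sqrt (∏ j ∈ Finset.range i.2.2, ((i.2.1 : ℝ) + j + 1)) : ℝ) : ℂ)

/-- z = a·(c†)^P̂. -/
def zOp : Module.End ℂ V3 := aOp * cdagPowP
/-- z† = a†·c^P̂. -/
def zdag : Module.End ℂ V3 := adag * cPowP

/-- The commutator [A,B] = AB − BA. -/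
def opComm (A B : Module.End ℂ V3) : Module.End ℂ V3 := A * B - B * A

/-- The stochastic-limit generator
L(X) = Γ_Z^a[z†,X]z − conj(Γ_Z^a)z†[z,X] + Γ_Z^b[z,X]z† − conj(Γ_Z^b)z[z†,X]
     + Γ_O^a[p†,X]p − conj(Γ_O^a)p†[p,X] + Γ_O^b[p,X]p† − conj(Γ_O^b)p[p†,X]. -/
def gen (ΓZa ΓZb ΓOa ΓOb : ℂ) (X : Module.End ℂ V3) : Module.End ℂ V3 :=
  ΓZa • (opComm zdag X * zOp) - (starRingEnd ℂ) ΓZa • (zdag * opComm zOp X)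
    + ΓZb • (opComm zOp X * zdag) - (starRingEnd ℂ) ΓZb • (zOp * opComm zdag X)
    + ΓOa • (opComm pdag X * pOp) - (starRingEnd ℂ) ΓOa • (pdag * opComm pOp X)
    + ΓOb • (opComm pOp X * pdag) - (starRingEnd ℂ) ΓOb • (pOp * opComm pdag X)

lemma lift_single (f : ℕ × ℕ × ℕ → V3) (i : ℕ × ℕ × ℕ) (x : ℂ) :
    Finsupp.lift V3 ℂ (ℕ × ℕ × ℕ) f (Finsupp.single i x) = x • f i := by
  rw [Finsupp.lift_apply, Finsupp.sum_single_index (zero_smul ℂ (f i))]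

lemma nhat_single (i : ℕ × ℕ × ℕ) (x : ℂ) :
    nhat (Finsupp.single i x) = (i.1 : ℂ) • Finsupp.single i x := by
  obtain ⟨n, k, m⟩ := i
  rw [nhat, Module.End.mul_apply, aOp, lift_single, map_smul, adag, lift_single]
  cases n with
  | zero => simp
  | succ n =>
    have h : ((Real.sqrt (n + 1) : ℝ) : ℂ) * ((Real.sqrt (n + 1) : ℝ) : ℂ) = n + 1 := by
      rw [← Complex.ofReal_mul, Real.mul_self_sqrt (by positivity)]
      push_cast
      rfl
    simp only [Nat.add_sub_cancel, Nat.cast_add_one, Finsupp.smul_single, smul_eq_mul, h]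
    rw [mul_comm]

/-- An operator sending each `φ_{n,k,m}` to an eigenvector of `n̂` of eigenvalue `n + d` has
commutator `-d` times itself with `n̂`. -/
lemma opComm_nhat_of_shift (T : Module.End ℂ V3) (d : ℂ)
    (hT : ∀ i, nhat (T (Finsupp.single i 1)) = ((i.1 : ℂ) + d) • T (Finsupp.single i 1)) :
    opComm T nhat = (-d) • T := by
  ext1 i
  ext1
  simp only [opComm, LinearMap.comp_apply, Finsupp.lsingle_apply, LinearMap.sub_apply,
    Module.End.mul_apply, LinearMap.smul_apply, nhat_single, map_smul, hT]
  module

lemma opComm_aOp_nhat : opComm aOp nhat = aOp := by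
  rw [opComm_nhat_of_shift aOp (-1), neg_neg, one_smul]
  rintro ⟨n, k, m⟩
  rw [aOp, lift_single, map_smul, nhat_single]
  cases n <;> simp

lemma opComm_adag_nhat : opComm adag nhat = (-1 : ℂ) • adag := by
  rw [opComm_nhat_of_shift adag 1]
  intro i
  rw [adag, lift_single, map_smul, nhat_single, smul_comm, Nat.cast_add_one]

lemma opComm_cPowP_nhat : opComm cPowP nhat = 0 := by
  rw [opComm_nhat_of_shift cPowP 0, neg_zero, zero_smul]
  intro i
  rw [cPowP, lift_single, map_smul, add_zero, smul_comm]
  split_ifs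
  · rw [nhat_single]
  · simp only [map_zero, smul_zero]

lemma opComm_cdagPowP_nhat : opComm cdagPowP nhat = 0 := by
  rw [opComm_nhat_of_shift cdagPowP 0, neg_zero, zero_smul]
  intro i
  rw [cdagPowP, lift_single, map_smul, nhat_single, add_zero, smul_comm]

lemma opComm_pOp_nhat : opComm pOp nhat = 0 := by
  rw [opComm_nhat_of_shift pOp 0, neg_zero, zero_smul]
  intro i
  rw [pOp, lift_single, map_smul, nhat_single, add_zero, smul_comm]

lemma opComm_pdag_nhat : opComm pdag nhat = 0 := by
  rw [opComm_nhat_of_shift pdag 0, neg_zero, zero_smul]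
  intro i
  rw [pdag, lift_single, map_smul, nhat_single, add_zero, smul_comm]

lemma opComm_mul_left (A B X : Module.End ℂ V3) :
    opComm (A * B) X = A * opComm B X + opComm A X * B := by
  refine LinearMap.ext fun v => ?_
  simp only [opComm, LinearMap.sub_apply, LinearMap.add_apply, Module.End.mul_apply, map_sub]
  abel

lemma opComm_zOp_nhat : opComm zOp nhat = zOp := by
  rw [zOp, opComm_mul_left, opComm_cdagPowP_nhat, opComm_aOp_nhat, mul_zero, zero_add]

lemma opComm_zdag_nhat : opComm zdag nhat = (-1 : ℂ) • zdag := by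
  rw [zdag, opComm_mul_left, opComm_cPowP_nhat, opComm_adag_nhat, mul_zero, zero_add, smul_mul_assoc]

/-- the stochastic-limit generator applied to the share number
operator: L(n̂) = 2·Re(Γ_Z^b)·z z† − 2·Re(Γ_Z^a)·z†z. -/
theorem generator_on_nhat (ΓZa ΓZb ΓOa ΓOb : ℂ) :
    gen ΓZa ΓZb ΓOa ΓOb nhat
      = ((2 * ΓZb.re : ℝ) : ℂ) • (zOp * zdag) - ((2 * ΓZa.re : ℝ) : ℂ) • (zdag * zOp) := by
  rw [gen, opComm_zOp_nhat, opComm_zdag_nhat, opComm_pOp_nhat, opComm_pdag_nhat,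
    ← Complex.add_conj, ← Complex.add_conj]
  refine LinearMap.ext fun v => ?_
  simp only [LinearMap.sub_apply, LinearMap.add_apply, LinearMap.smul_apply, LinearMap.zero_apply,
    Module.End.mul_apply, map_smul, map_zero, smul_zero]
  module

end
end

section
/- The stochastic-limit generator L applied to the portfolio operator Π̂ = P̂·n̂ + k̂ does not depend on Γ_Z^a, Γ_Z^b and equals L(Π̂) = 2·( Re(Γ_O^b) − Re(Γ_O^a) )·P̂·n̂ + 2·Re(Γ_O^b)·n̂ as linear operators on V; in particular, if Re(Γ_O^a) = Re(Γ_O^b) = 0 then L(Π̂) = 0 (stationarity of the portfolio). -/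
/- Context: V is the free complex vector space on the basis
{φ_{n,k,m} : n, k, m ∈ ℕ} (share number n, cash k, price m). -/

noncomputable section

theorem aOp_single (n k m : ℕ) (x : ℂ) : aOp (Finsupp.single (n, k, m) x) =
    Finsupp.single (n - 1, k, m) (x * (Real.sqrt n : ℝ)) := by
  simp [aOp]

theorem adag_single (n k m : ℕ) (x : ℂ) : adag (Finsupp.single (n, k, m) x) =
    Finsupp.single (n + 1, k, m) (x * (Real.sqrt (n + 1) : ℝ)) := by
  simp [adag]

theorem cOp_single (n k m : ℕ) (x : ℂ) : cOp (Finsupp.single (n, k, m) x) =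
    Finsupp.single (n, k - 1, m) (x * (Real.sqrt k : ℝ)) := by
  simp [cOp]

theorem cdag_single (n k m : ℕ) (x : ℂ) : cdag (Finsupp.single (n, k, m) x) =
    Finsupp.single (n, k + 1, m) (x * (Real.sqrt (k + 1) : ℝ)) := by
  simp [cdag]

theorem pOp_single (n k m : ℕ) (x : ℂ) : pOp (Finsupp.single (n, k, m) x) =
    Finsupp.single (n, k, m - 1) (x * (Real.sqrt m : ℝ)) := by
  simp [pOp]

theorem pdag_single (n k m : ℕ) (x : ℂ) : pdag (Finsupp.single (n, k, m) x) =
    Finsupp.single (n, k, m + 1) (x * (Real.sqrt (m + 1) : ℝ)) := by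
  simp [pdag]

theorem ofReal_sqrt_mul_self {r : ℝ} (hr : 0 ≤ r) :
    ((Real.sqrt r : ℝ) : ℂ) * (Real.sqrt r : ℝ) = r := by
  rw [← Complex.ofReal_mul, Real.mul_self_sqrt hr]

theorem nhat_single_s18 (n k m : ℕ) (x : ℂ) :
    nhat (Finsupp.single (n, k, m) x) = (n : ℂ) • Finsupp.single (n, k, m) x := by
  rw [nhat, Module.End.mul_apply, aOp_single, adag_single]
  cases n with
  | zero => simp
  | succ n =>
    have h := ofReal_sqrt_mul_self (r := (n : ℝ) + 1) (by positivity)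
    push_cast at h
    simp [-Finsupp.single_mul, -Finsupp.single_add, mul_assoc, h]
    rw [mul_comm]

theorem khat_single (n k m : ℕ) (x : ℂ) :
    khat (Finsupp.single (n, k, m) x) = (k : ℂ) • Finsupp.single (n, k, m) x := by
  rw [khat, Module.End.mul_apply, cOp_single, cdag_single]
  cases k with
  | zero => simp
  | succ k =>
    have h := ofReal_sqrt_mul_self (r := (k : ℝ) + 1) (by positivity)
    push_cast at h
    simp [-Finsupp.single_mul, -Finsupp.single_add, mul_assoc, h]
    rw [mul_comm]

theorem Phat_single (n k m : ℕ) (x : ℂ) :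
    Phat (Finsupp.single (n, k, m) x) = (m : ℂ) • Finsupp.single (n, k, m) x := by
  rw [Phat, Module.End.mul_apply, pOp_single, pdag_single]
  cases m with
  | zero => simp
  | succ m =>
    have h := ofReal_sqrt_mul_self (r := (m : ℝ) + 1) (by positivity)
    push_cast at h
    simp [-Finsupp.single_mul, -Finsupp.single_add, mul_assoc, h]
    rw [mul_comm]

theorem pOp_mul_pdag : pOp * pdag = Phat + 1 := by
  refine Finsupp.lhom_ext fun i x => ?_
  obtain ⟨n, k, m⟩ := i
  have h := ofReal_sqrt_mul_self (r := (m : ℝ) + 1) (by positivity)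
  push_cast at h
  simp [-Finsupp.single_mul, pOp_single, pdag_single, Phat_single, mul_assoc, h,
    ← Finsupp.single_add]
  ring_nf

theorem commute_pOp_nhat : Commute pOp nhat := by
  refine Finsupp.lhom_ext fun i x => ?_
  obtain ⟨n, k, m⟩ := i
  simp only [Module.End.mul_apply, map_smul, pOp_single, nhat_single_s18]

theorem commute_pdag_nhat : Commute pdag nhat := by
  refine Finsupp.lhom_ext fun i x => ?_
  obtain ⟨n, k, m⟩ := i
  simp only [Module.End.mul_apply, map_smul, pdag_single, nhat_single_s18]

theorem commute_pOp_khat : Commute pOp khat := by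
  refine Finsupp.lhom_ext fun i x => ?_
  obtain ⟨n, k, m⟩ := i
  simp only [Module.End.mul_apply, map_smul, pOp_single, khat_single]

theorem commute_pdag_khat : Commute pdag khat := by
  refine Finsupp.lhom_ext fun i x => ?_
  obtain ⟨n, k, m⟩ := i
  simp only [Module.End.mul_apply, map_smul, pdag_single, khat_single]

theorem portfolio_single (n k m : ℕ) (x : ℂ) :
    (Phat * nhat + khat) (Finsupp.single (n, k, m) x) =
      ((m : ℂ) * n + k) • Finsupp.single (n, k, m) x := by
  simp only [LinearMap.add_apply, Module.End.mul_apply, nhat_single_s18, map_smul, Phat_single,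
    khat_single, smul_smul, add_smul, mul_comm (m : ℂ)]

theorem commute_zOp_portfolio : Commute zOp (Phat * nhat + khat) := by
  refine Finsupp.lhom_ext fun i x => ?_
  obtain ⟨n, k, m⟩ := i
  have hz : ∃ y : ℂ, zOp (Finsupp.single (n, k, m) x) =
      Finsupp.single (n - 1, k + m, m) (y * (Real.sqrt n : ℝ)) :=
    ⟨_, by rw [zOp, Module.End.mul_apply, cdagPowP]; simp [-Finsupp.single_mul, aOp_single]; rfl⟩
  obtain ⟨y, hy⟩ := hz
  rw [Module.End.mul_apply, Module.End.mul_apply, portfolio_single, map_smul, hy,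
    portfolio_single]
  cases n with
  | zero => simp
  | succ n =>
    congr 1
    simp only [Nat.add_sub_cancel]
    push_cast
    ring

theorem commute_zdag_portfolio : Commute zdag (Phat * nhat + khat) := by
  refine Finsupp.lhom_ext fun i x => ?_
  obtain ⟨n, k, m⟩ := i
  rw [Module.End.mul_apply, Module.End.mul_apply, portfolio_single, map_smul]
  by_cases hmk : m ≤ k
  · have hz : ∃ y, zdag (Finsupp.single (n, k, m) x) = Finsupp.single (n + 1, k - m, m) y :=
      ⟨_, by rw [zdag, Module.End.mul_apply, cPowP]; simp [-Finsupp.single_mul, hmk, adag_single]; rfl⟩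
    obtain ⟨y, hy⟩ := hz
    rw [hy, portfolio_single]
    congr 1
    push_cast [hmk]
    ring
  · have hz : zdag (Finsupp.single (n, k, m) x) = 0 := by
      rw [zdag, Module.End.mul_apply, cPowP]; simp [hmk]
    simp [hz]

theorem opComm_eq_zero {A B : Module.End ℂ V3} (h : Commute A B) : opComm A B = 0 :=
  sub_eq_zero.2 h.eq

theorem opComm_pOp_portfolio : opComm pOp (Phat * nhat + khat) = pOp * nhat := by
  have h : Phat * nhat * pOp = Phat * pOp * nhat := by
    rw [mul_assoc, ← commute_pOp_nhat.eq, mul_assoc]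
  have h2 : pOp * Phat = Phat * pOp + pOp := by
    rw [Phat, ← mul_assoc, pOp_mul_pdag, add_mul, one_mul, Phat]
  rw [opComm, mul_add, add_mul, commute_pOp_khat.eq, h, ← mul_assoc, h2, add_mul]
  abel

theorem opComm_pdag_portfolio : opComm pdag (Phat * nhat + khat) = -(pdag * nhat) := by
  have h : Phat * nhat * pdag = Phat * pdag * nhat := by
    rw [mul_assoc, ← commute_pdag_nhat.eq, mul_assoc]
  have h2 : Phat * pdag = pdag * Phat + pdag := by
    nth_rewrite 1 [Phat]
    rw [mul_assoc, pOp_mul_pdag, mul_add, mul_one]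
  rw [opComm, mul_add, add_mul, commute_pdag_khat.eq, h, ← mul_assoc, h2, add_mul]
  abel

theorem gen_portfolio (ΓZa ΓZb ΓOa ΓOb : ℂ) :
    gen ΓZa ΓZb ΓOa ΓOb (Phat * nhat + khat)
      = ((2 * (ΓOb.re - ΓOa.re) : ℝ) : ℂ) • (Phat * nhat)
        + ((2 * ΓOb.re : ℝ) : ℂ) • nhat := by
  have ha := Complex.add_conj ΓOa
  have hb := Complex.add_conj ΓOb
  push_cast at ha hb
  have h1 : -(pdag * nhat) * pOp = -(Phat * nhat) := by
    refine (LinearMap.neg_comp pOp (pdag * nhat)).trans ?_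
    rw [← Module.End.mul_eq_comp, mul_assoc, ← commute_pOp_nhat.eq, ← mul_assoc, Phat]
  have h2 : pdag * (pOp * nhat) = Phat * nhat := by rw [← mul_assoc, Phat]
  have h3 : pOp * nhat * pdag = Phat * nhat + nhat := by
    rw [mul_assoc, ← commute_pdag_nhat.eq, ← mul_assoc, pOp_mul_pdag, add_mul, one_mul]
  have h4 : pOp * -(pdag * nhat) = -(Phat * nhat + nhat) := by
    refine (LinearMap.comp_neg (pdag * nhat) pOp).trans ?_
    rw [← Module.End.mul_eq_comp, ← mul_assoc, pOp_mul_pdag, add_mul, one_mul]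
  rw [gen, opComm_eq_zero commute_zOp_portfolio, opComm_eq_zero commute_zdag_portfolio,
    opComm_pOp_portfolio, opComm_pdag_portfolio]
  simp only [zero_mul, mul_zero, smul_zero, add_zero, h1, h2, h3, h4]
  push_cast
  rw [mul_sub, ← ha, ← hb]
  module

/-- the stochastic-limit generator applied to the portfolio
Π̂ = P̂n̂ + k̂ does not depend on Γ_Z^a, Γ_Z^b and equals
L(Π̂) = 2(Re(Γ_O^b) − Re(Γ_O^a))·P̂n̂ + 2Re(Γ_O^b)·n̂; in particular if
Re(Γ_O^a) = Re(Γ_O^b) = 0 then L(Π̂) = 0 (stationarity of the portfolio). -/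
theorem generator_on_portfolio (ΓZa ΓZb ΓOa ΓOb : ℂ) :
    gen ΓZa ΓZb ΓOa ΓOb (Phat * nhat + khat)
      = ((2 * (ΓOb.re - ΓOa.re) : ℝ) : ℂ) • (Phat * nhat)
        + ((2 * ΓOb.re : ℝ) : ℂ) • nhat ∧
    (ΓOa.re = 0 → ΓOb.re = 0 → gen ΓZa ΓZb ΓOa ΓOb (Phat * nhat + khat) = 0) := by
  refine ⟨gen_portfolio ΓZa ΓZb ΓOa ΓOb, fun ha hb => ?_⟩
  rw [gen_portfolio, ha, hb]
  simp

end
end
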